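/- arXiv:1010.3582 — 2 statements merged into one kernel-verified Lean document; each statement's English description precedes it below -/
import Mathlib

section
/- Let $P \subset \mathbb{R}^d$ be a convex body of volume $1$, $z \in P$ with $v(z) = s$ where $0 < s < \tfrac12$, and let $T \geq s$. Let $C(z) = \{x \in \mathbb{R}^d : u \cdot x \geq h_P(u) - h_z\} \cap P$ be a minimal cap of $z$, and set $\beta = 2ed^3 + 1$. Then the set $S(z,T) = \{x \in P : [x,z] \cap P(v \geq T) = \varnothing\}$ of points visible from $z$ within $P(v < T)$ satisfies $$S(z,T) \subset C^{\beta T / s}(z).$$ -/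
open MeasureTheory
open scoped RealInnerProductSpace

/-- The minimal cap volume function `v(z) = min{V(P ∩ H) : H a closed half-space, z ∈ H}`. -/
noncomputable def vfun {d : ℕ} (P : Set (EuclideanSpace ℝ (Fin d)))
    (z : EuclideanSpace ℝ (Fin d)) : ℝ :=
  sInf {r | ∃ (u : EuclideanSpace ℝ (Fin d)) (c : ℝ), u ≠ 0 ∧ c ≤ ⟪u, z⟫ ∧
    r = (volume (P ∩ {x | c ≤ ⟪u, x⟫})).toReal}

open Filter Topology
open scoped Pointwise

lemma one_add_inv_pow_le_exp (n : ℕ) : (1 + 1 / (n : ℝ)) ^ n ≤ Real.exp 1 := by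
  rcases Nat.eq_zero_or_pos n with rfl | hn
  · simp
  have hn' : (0 : ℝ) < n := by exact_mod_cast hn
  calc (1 + 1 / (n : ℝ)) ^ n ≤ (Real.exp (1 / n)) ^ n := by
        gcongr
        linarith [Real.add_one_le_exp (1 / (n : ℝ))]
    _ = Real.exp 1 := by
        rw [← Real.exp_nat_mul]; congr 1; field_simp

lemma one_add_pow_le_succ (n : ℕ) {r : ℝ} (hr0 : 0 ≤ r) (hr : r ≤ 1 / (n + 1)) :
    (1 + r) ^ n ≤ n + 1 := by
  have hn : (0 : ℝ) < n + 1 := by positivity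
  calc (1 + r) ^ n ≤ (Real.exp (1 / (n + 1))) ^ n := by
        gcongr
        linarith [Real.add_one_le_exp (1 / ((n : ℝ) + 1))]
    _ = Real.exp (n * (1 / (n + 1))) := by rw [← Real.exp_nat_mul]
    _ ≤ Real.exp (Real.log (n + 1)) := by
        gcongr
        have := Real.one_sub_inv_le_log_of_pos hn
        have h2 : (n : ℝ) * (1 / (n + 1)) = 1 - (n + 1 : ℝ)⁻¹ := by field_simp; ring
        linarith
    _ = n + 1 := Real.exp_log hn

lemma real_inter_Ici_cases {S : Set ℝ} (hS : IsCompact S) (hSc : Convex ℝ S) :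
    S = ∅ ∨ ∃ α β : ℝ, α ≤ β ∧ S = Set.Icc α β ∧
      ∀ c, volume.real (S ∩ Set.Ici c) = max (β - max α c) 0 := by
  rcases S.eq_empty_or_nonempty with h | h
  · exact Or.inl h
  · right
    have e := eq_Icc_of_connected_compact ⟨h, hSc.isPreconnected⟩ hS
    refine ⟨sInf S, sSup S, Real.sInf_le_sSup _ hS.bddBelow hS.bddAbove, e, fun c => ?_⟩
    have : S ∩ Set.Ici c = Set.Icc (max (sInf S) c) (sSup S) := by
      conv_lhs => rw [e]
      ext x; simp only [Set.mem_inter_iff, Set.mem_Icc, Set.mem_Ici, max_le_iff]; tauto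
    rw [this, Measure.real, Real.volume_Icc, ENNReal.toReal_ofReal']

lemma abs_volume_inter_Ici_sub_le {S : Set ℝ} (hS : IsCompact S) (hSc : Convex ℝ S) (c : ℝ) :
    |volume.real (S ∩ Set.Ici c) - volume.real (S ∩ Set.Ici 0)| ≤ |c| := by
  rcases real_inter_Ici_cases hS hSc with rfl | ⟨α, β, -, -, h⟩
  · simp
  · rw [h, h]
    calc |max (β - max α c) 0 - max (β - max α 0) 0| ≤ |(β - max α c) - (β - max α 0)| :=
          abs_max_sub_max_le_abs _ _ _
      _ = |max 0 α - max c α| := by rw [max_comm α, max_comm α]; congr 1; ring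
      _ ≤ |0 - c| := abs_max_sub_max_le_abs _ _ _
      _ = |c| := by simp

lemma eventually_volume_inter_Ici_of_mem_nhds {S : Set ℝ} (hS : IsCompact S) (hSc : Convex ℝ S)
    (h0 : S ∈ 𝓝 0) :
    ∀ᶠ c in 𝓝 0, volume.real (S ∩ Set.Ici c) - volume.real (S ∩ Set.Ici 0) = -c := by
  rcases real_inter_Ici_cases hS hSc with rfl | ⟨α, β, -, hS', h⟩
  · simp at h0
  · rw [hS', Icc_mem_nhds_iff] at h0
    filter_upwards [Ioo_mem_nhds h0.1 h0.2] with c hc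
    rw [h, h, max_eq_right hc.1.le, max_eq_right h0.1.le, max_eq_left, max_eq_left] <;>
      linarith [hc.2, h0.2]

lemma eventually_volume_inter_Ici_of_notMem {S : Set ℝ} (hS : IsCompact S) (hSc : Convex ℝ S)
    (h0 : 0 ∉ S) :
    ∀ᶠ c in 𝓝 0, volume.real (S ∩ Set.Ici c) - volume.real (S ∩ Set.Ici 0) = 0 := by
  rcases real_inter_Ici_cases hS hSc with rfl | ⟨α, β, hαβ, hS', h⟩
  · simp
  · rw [hS', Set.mem_Icc, not_and_or, not_le, not_le] at h0
    rcases h0 with h0 | h0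
    · filter_upwards [Iio_mem_nhds h0] with c hc
      have hc' : c < α := hc
      rw [h, h, max_eq_left (le_of_lt hc'), max_eq_left h0.le, sub_self]
    · filter_upwards [Ioi_mem_nhds h0] with c hc
      have hc' : β < c := hc
      rw [h, h, max_eq_right (b := (0 : ℝ)), max_eq_right (b := (0 : ℝ)), sub_self]
      · linarith [le_max_right α 0]
      · linarith [le_max_right α c]

section

variable {F : Type*} [NormedAddCommGroup F]

lemma isCompact_section {Q : Set (ℝ × F)} (hQ : IsCompact Q) (t : ℝ) :
    IsCompact {p | (t, p) ∈ Q} :=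
  (hQ.image continuous_snd).of_isClosed_subset
    (hQ.isClosed.preimage (continuous_const.prodMk continuous_id)) fun p hp => ⟨(t, p), hp, rfl⟩

variable [NormedSpace ℝ F]

lemma convex_section {Q : Set (ℝ × F)} (hQ : Convex ℝ Q) (t : ℝ) :
    Convex ℝ {p | (t, p) ∈ Q} := by
  intro p hp q hq a b ha hb hab
  have := hQ hp hq ha hb hab
  have e : a • (t, p) + b • (t, q) = (t, a • p + b • q) := by
    ext
    · simp [← add_mul, hab]
    · simp
  rwa [e] at this

lemma exists_mem_fiber_of_mem_interior {Q : Set (ℝ × F)} (hQc : Convex ℝ Q) {t₁ : ℝ} {p₁ p : F}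
    (h₁ : (t₁, p₁) ∈ Q) (hp : p ∈ interior {p | ((0 : ℝ), p) ∈ Q}) :
    ∃ δ : ℝ, 0 < δ ∧ (δ * t₁, p) ∈ Q := by
  have ht : Tendsto (fun δ : ℝ => (1 - δ)⁻¹ • (p - δ • p₁)) (𝓝[>] 0) (𝓝 p) := by
    have : ContinuousAt (fun δ : ℝ => (1 - δ)⁻¹ • (p - δ • p₁)) 0 := by
      apply ContinuousAt.smul
      · exact ContinuousAt.inv₀ (by fun_prop) (by norm_num)
      · fun_prop
    have h2 := this.tendsto
    simp only [sub_zero, inv_one, zero_smul, one_smul] at h2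
    exact h2.mono_left nhdsWithin_le_nhds
  have h1 := ht.eventually (mem_interior_iff_mem_nhds.1 hp)
  have h2 : Set.Ioo (0 : ℝ) 1 ∈ 𝓝[>] 0 := Ioo_mem_nhdsGT one_pos
  obtain ⟨δ, hδ, hδ0, hδ1⟩ := (h1.and h2).exists
  refine ⟨δ, hδ0, ?_⟩
  have h4 := hQc hδ h₁ (a := 1 - δ) (b := δ) (by linarith) hδ0.le (by ring)
  have hne : 1 - δ ≠ 0 := by linarith
  convert h4 using 1
  ext
  · simp
  · simp [smul_smul, mul_inv_cancel₀ hne]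

end

section

variable {F : Type*} [NormedAddCommGroup F] [NormedSpace ℝ F] [FiniteDimensional ℝ F]
  [MeasurableSpace F] [BorelSpace F]

/-- A weak form of Grünbaum's inequality, with `1 / (n + e)` in place of `1 / e`. -/
lemma measureReal_le_mul_measureReal_inter_halfspace (ν : Measure F) [ν.IsAddHaarMeasure]
    {K : Set F} (hK : IsCompact K) (hKc : Convex ℝ K) (b : F →L[ℝ] ℝ)
    (hb : 0 ≤ ∫ p in K, b p ∂ν) :
    ν.real K ≤ (Module.finrank ℝ F + Real.exp 1) * ν.real (K ∩ {p | 0 ≤ b p}) := by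
  set n := Module.finrank ℝ F with hn
  rcases K.eq_empty_or_nonempty with rfl | hne
  · simp
  have hfin : ∀ S : Set F, S ⊆ K → ν S ≠ ⊤ := fun S hS =>
    ((measure_mono hS).trans_lt hK.measure_lt_top).ne
  have hmpos : MeasurableSet {p : F | 0 ≤ b p} := (isClosed_le continuous_const b.continuous).measurableSet
  have hbint : IntegrableOn (fun p => b p) K ν := b.continuous.continuousOn.integrableOn_compact hK
  obtain ⟨p₀, hp₀, hmax⟩ := hK.exists_isMaxOn hne b.continuous.continuousOn
  have hmax' : ∀ p ∈ K, b p ≤ b p₀ := fun p hp => hmax hp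
  have he : 1 ≤ Real.exp 1 := Real.one_le_exp zero_le_one
  rcases le_or_gt (b p₀) 0 with hM | hM
  · have hae : ∀ᵐ p ∂(ν.restrict K), 0 ≤ b p := by
      have h0 : 0 ≤ᵐ[ν.restrict K] fun p => - b p := by
        filter_upwards [ae_restrict_mem hK.measurableSet] with p hp
        have := hmax' p hp
        simp only [Pi.zero_apply]; linarith
      have h1 : ∫ p in K, - b p ∂ν = 0 := by
        apply le_antisymm
        · rw [integral_neg]; linarith
        · exact integral_nonneg_of_ae h0
      have h2 := (integral_eq_zero_iff_of_nonneg_ae h0 hbint.neg).1 h1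
      filter_upwards [h2] with p hp
      simp only [Pi.zero_apply] at hp; linarith
    have hEq : ν.real (K ∩ {p | 0 ≤ b p}) = ν.real K := by
      have : (ν.restrict K) {p | 0 ≤ b p} = (ν.restrict K) Set.univ :=
        measure_congr (Filter.eventuallyEq_univ.2 hae)
      rw [Measure.restrict_apply hmpos, Measure.restrict_apply_univ, Set.inter_comm] at this
      simp [Measure.real, this]
    rw [hEq]
    have : 0 ≤ ν.real K := measureReal_nonneg
    have : (0 : ℝ) ≤ n := by positivity
    nlinarith
  have hnpos : 0 < n := by
    rw [hn, Module.finrank_pos_iff_exists_ne_zero]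
    exact ⟨p₀, fun h => by simp [h] at hM⟩
  have hn' : (0 : ℝ) < n := by exact_mod_cast hnpos
  set M := b p₀
  set Kp := K ∩ {p | 0 ≤ b p}
  set Kf := K ∩ {p | -(M / n) ≤ b p}
  set Kl := K ∩ {p | b p < -(M / n)}
  have hsplit : ν.real K = ν.real Kf + ν.real Kl := by
    have hd : Kl = K \ {p | -(M / n) ≤ b p} := by ext p; simp [Kl]
    rw [hd, measureReal_inter_add_sdiff _ (h := hfin K le_rfl)]
    exact (isClosed_le continuous_const b.continuous).measurableSet
  have hcontract : ν.real Kf ≤ Real.exp 1 * ν.real Kp := by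
    have hsub : Kf ⊆ (AffineMap.homothety p₀ (1 + 1 / (n : ℝ))) '' Kp := by
      rintro p ⟨hp, hpb⟩
      simp only [Set.mem_ofPred_eq] at hpb
      refine ⟨AffineMap.homothety p₀ ((n : ℝ) / (n + 1)) p, ⟨?_, ?_⟩, ?_⟩
      · have := hKc.lineMap_mem hp₀ hp (t := (n : ℝ) / (n + 1))
          ⟨by positivity, by rw [div_le_one (by positivity)]; linarith⟩
        simpa [AffineMap.homothety_eq_lineMap] using this
      · simp only [AffineMap.homothety_apply, vsub_eq_sub, vadd_eq_add, Set.mem_ofPred_eq,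
          map_add, map_smul, map_sub, smul_eq_mul]
        change 0 ≤ (n : ℝ) / (n + 1) * (b p - M) + M
        have : -(M / n) * n ≤ b p * n := by gcongr
        have h3 : -M ≤ b p * n := by
          calc -M = -(M / n) * n := by field_simp
            _ ≤ _ := this
        have : (n : ℝ) / (n + 1) * (b p - M) + M = (b p * n + M) / (n + 1) := by
          field_simp; ring
        rw [this]
        apply div_nonneg <;> linarith
      · rw [← AffineMap.comp_apply, ← AffineMap.homothety_mul]
        have : (1 + 1 / (n : ℝ)) * (n / (n + 1)) = 1 := by field_simp
        rw [this]; simp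
    have h1 := measure_mono (μ := ν) hsub
    rw [Measure.addHaar_image_homothety] at h1
    have h2 : ν.real Kf ≤ (1 + 1 / (n : ℝ)) ^ n * ν.real Kp := by
      have := ENNReal.toReal_mono (ENNReal.mul_ne_top ENNReal.ofReal_ne_top
        (hfin Kp Set.inter_subset_left)) h1
      rwa [ENNReal.toReal_mul, ENNReal.toReal_ofReal (abs_nonneg _), abs_of_nonneg (by positivity)] at this
    refine h2.trans ?_
    gcongr
    exact one_add_inv_pow_le_exp n
  have hmarkov : M / n * ν.real Kl ≤ M * ν.real Kp := by
    have hml : MeasurableSet Kl := hK.measurableSet.inter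
      (isOpen_lt b.continuous continuous_const).measurableSet
    have hmp : MeasurableSet Kp := hK.measurableSet.inter hmpos
    have hpt : ∀ p ∈ K, b p ≤ Kp.indicator (fun _ => M) p - Kl.indicator (fun _ => M / n) p := by
      intro p hp
      have hMn : 0 < M / n := by positivity
      by_cases h1 : 0 ≤ b p
      · have h2 : p ∉ Kl := fun h => by
          have := h.2; simp only [Set.mem_ofPred_eq] at this; linarith
        rw [Set.indicator_of_mem (show p ∈ Kp from ⟨hp, h1⟩), Set.indicator_of_notMem h2, sub_zero]
        exact hmax' p hp
      · rw [Set.indicator_of_notMem (fun h : p ∈ Kp => h1 h.2)]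
        by_cases h2 : p ∈ Kl
        · rw [Set.indicator_of_mem h2]
          have := h2.2; simp only [Set.mem_ofPred_eq] at this; linarith
        · rw [Set.indicator_of_notMem h2]; push Not at h1; linarith
    have hi1 : IntegrableOn (Kp.indicator fun _ => M) K ν :=
      (integrableOn_const hK.measure_lt_top.ne).indicator hmp
    have hi2 : IntegrableOn (Kl.indicator fun _ => M / n) K ν :=
      (integrableOn_const hK.measure_lt_top.ne).indicator hml
    have h3 : ∫ p in K, b p ∂ν ≤
        ∫ p in K, (Kp.indicator (fun _ => M) p - Kl.indicator (fun _ => M / n) p) ∂ν :=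
      setIntegral_mono_on hbint (hi1.sub hi2) hK.measurableSet hpt
    rw [integral_sub hi1 hi2, setIntegral_indicator hmp, setIntegral_indicator hml,
      setIntegral_const, setIntegral_const, Set.inter_eq_self_of_subset_right Set.inter_subset_left,
      Set.inter_eq_self_of_subset_right Set.inter_subset_left] at h3
    simp only [smul_eq_mul] at h3
    linarith
  have hKl : ν.real Kl ≤ n * ν.real Kp := by
    have : M / n * ν.real Kl ≤ M / n * (n * ν.real Kp) := by
      calc _ ≤ _ := hmarkov
        _ = _ := by field_simp
    exact le_of_mul_le_mul_left this (by positivity)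
  rw [hsplit]; linarith

lemma measure_cap_le_of_apex (ν : Measure F) [ν.IsAddHaarMeasure] {Q : Set (ℝ × F)}
    (hQ : IsCompact Q) (hQc : Convex ℝ Q) {τ η : ℝ} (hτ : 0 < τ) (hη : 0 < η)
    (h0 : (0, 0) ∈ Q) (hx : (-τ, 0) ∈ Q) (hcap : ∀ q ∈ Q, q.1 ≤ η) :
    (volume.prod ν).real (Q ∩ {q | 0 ≤ q.1}) ≤
      η * (1 + η / τ) ^ Module.finrank ℝ F * ν.real {p | (0, p) ∈ Q} := by
  have hKc := convex_section hQc 0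
  have hK := isCompact_section hQ 0
  set K := {p | ((0 : ℝ), p) ∈ Q}
  have hsub : Q ∩ {q | 0 ≤ q.1} ⊆ Set.Icc 0 η ×ˢ ((1 + η / τ) • K) := by
    rintro ⟨t, p⟩ ⟨hq, ht⟩
    simp only [Set.mem_ofPred_eq] at ht
    have htη : t ≤ η := hcap _ hq
    refine ⟨⟨ht, htη⟩, ?_⟩
    rw [Set.mem_smul_set_iff_inv_smul_mem₀ (by positivity)]
    have h1 : (τ / (τ + t)) • p ∈ K := by
      have := hQc hq hx (a := τ / (τ + t)) (b := t / (τ + t)) (by positivity) (by positivity)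
        (by field_simp)
      change ((0 : ℝ), (τ / (τ + t)) • p) ∈ Q
      convert this using 1
      ext
      · simp; field_simp; ring
      · simp
    have h2 : (0 : F) ∈ K := h0
    have h3 := hKc.smul_mem_of_zero_mem h2 h1 (t := (τ + t) / (τ + η))
      ⟨by positivity, by rw [div_le_one (by positivity)]; linarith⟩
    rw [smul_smul] at h3
    convert h3 using 2
    field_simp
  have hfin : (volume.prod ν) (Set.Icc 0 η ×ˢ ((1 + η / τ) • K)) ≠ ⊤ := by
    exact (isCompact_Icc.prod (hK.smul _)).measure_lt_top.ne
  refine (measureReal_mono hsub hfin).trans ?_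
  rw [measureReal_prod_prod, mul_assoc]
  have : ν.real ((1 + η / τ) • K) = (1 + η / τ) ^ Module.finrank ℝ F * ν.real K := by
    rw [Measure.real, Measure.addHaar_smul_of_nonneg ν (by positivity), ENNReal.toReal_mul,
      ENNReal.toReal_ofReal (by positivity), Measure.real]
  rw [this]
  simp [hη.le]

lemma measure_cone_le (ν : Measure F) [ν.IsAddHaarMeasure] {B : Set F} {G : Set (ℝ × F)}
    (hG : MeasurableSet G) (hGfin : (volume.prod ν) G ≠ ⊤) {τ α β : ℝ} (hτ : 0 < τ)
    (hα : -τ ≤ α) (hαβ : α ≤ β) (hsub : ∀ t ∈ Set.Icc α β, ∀ p ∈ B, (t, (1 + t / τ) • p) ∈ G) :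
    τ / (Module.finrank ℝ F + 1) * ((1 + β / τ) ^ (Module.finrank ℝ F + 1) -
      (1 + α / τ) ^ (Module.finrank ℝ F + 1)) * ν.real B ≤ (volume.prod ν).real G := by
  set n := Module.finrank ℝ F with hn
  have hpos : ∀ t ∈ Set.Icc α β, 0 ≤ 1 + t / τ := by
    intro t ht
    have : -1 ≤ t / τ := by rw [le_div_iff₀ hτ]; linarith [ht.1]
    linarith
  have hcont : Continuous fun t : ℝ => (1 + t / τ) ^ n := by fun_prop
  have hint : ∫ t in Set.Icc α β, (1 + t / τ) ^ n =
      τ / (n + 1) * ((1 + β / τ) ^ (n + 1) - (1 + α / τ) ^ (n + 1)) := by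
    rw [integral_Icc_eq_integral_Ioc, ← intervalIntegral.integral_of_le hαβ,
      intervalIntegral.integral_comp_add_div (fun x => x ^ n) hτ.ne', integral_pow, smul_eq_mul]
    field_simp
  have hle : ENNReal.ofReal (∫ t in Set.Icc α β, (1 + t / τ) ^ n) * ν B ≤
      (volume.prod ν) G := by
    rw [ofReal_integral_eq_lintegral_ofReal hcont.continuousOn.integrableOn_Icc,
      ← lintegral_mul_const _ (by fun_prop), Measure.prod_apply hG]
    · refine le_trans ?_ (setLIntegral_le_lintegral (Set.Icc α β) _)
      refine setLIntegral_mono' measurableSet_Icc fun t ht => ?_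
      rw [← Measure.addHaar_smul_of_nonneg ν (hpos t ht)]
      refine measure_mono ?_
      rintro _ ⟨p, hp, rfl⟩
      exact hsub t ht p hp
    · filter_upwards [ae_restrict_mem measurableSet_Icc] with t ht
      exact pow_nonneg (hpos t ht) n
  have := ENNReal.toReal_mono hGfin hle
  rwa [ENNReal.toReal_mul, ENNReal.toReal_ofReal, hint] at this
  exact setIntegral_nonneg measurableSet_Icc fun t ht => pow_nonneg (hpos t ht) n

/-- If tilting the cap `{0 ≤ t}` of `Q` in the direction `b` never decreases its volume, then the
moment of `b` over the section `{t = 0}` is nonnegative. -/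
lemma setIntegral_section_nonneg_of_tilt (ν : Measure F) [ν.IsAddHaarMeasure] {Q : Set (ℝ × F)}
    (hQ : IsCompact Q) (hQc : Convex ℝ Q) {t₁ t₂ : ℝ} {p₁ p₂ : F} (ht₁ : t₁ < 0) (ht₂ : 0 < t₂)
    (h₁ : (t₁, p₁) ∈ Q) (h₂ : (t₂, p₂) ∈ Q) (b : F →L[ℝ] ℝ)
    (hb : ∀ ε > 0, (volume.prod ν).real (Q ∩ {q | 0 ≤ q.1}) ≤
      (volume.prod ν).real (Q ∩ {q | 0 ≤ q.1 + ε * b q.2})) :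
    0 ≤ ∫ p in {p | ((0 : ℝ), p) ∈ Q}, b p ∂ν := by
  have hKc := convex_section hQc 0
  set K := {p | ((0 : ℝ), p) ∈ Q} with hKdef
  have hKcl : IsClosed K := (isCompact_section hQ 0).isClosed
  let S : F → Set ℝ := fun p => {t | (t, p) ∈ Q}
  have hS : ∀ p, IsCompact (S p) := fun p => (hQ.image continuous_fst).of_isClosed_subset
    (hQ.isClosed.preimage (continuous_id.prodMk continuous_const)) fun t ht => ⟨(t, p), ht, rfl⟩
  have hSc : ∀ p, Convex ℝ (S p) := by
    intro p x hx y hy a b ha hb hab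
    have := hQc hx hy ha hb hab
    have e : a • (x, p) + b • (y, p) = (a • x + b • y, p) := by
      ext
      · simp
      · simp [← add_smul, hab]
    rwa [e] at this
  let D : ℝ → F → ℝ := fun ε p =>
    volume.real (S p ∩ Set.Ici (-(ε * b p))) - volume.real (S p ∩ Set.Ici 0)
  have hmeas : ∀ ε : ℝ, MeasurableSet (Q ∩ {q : ℝ × F | 0 ≤ q.1 + ε * b q.2}) := fun ε =>
    hQ.measurableSet.inter (isClosed_le continuous_const (by fun_prop)).measurableSet
  have hfin : ∀ ε : ℝ, (volume.prod ν) (Q ∩ {q : ℝ × F | 0 ≤ q.1 + ε * b q.2}) ≠ ⊤ := fun ε =>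
    ((measure_mono Set.inter_subset_left).trans_lt hQ.measure_lt_top).ne
  have hfib : ∀ (ε : ℝ) (p : F), (fun t : ℝ => (t, p)) ⁻¹' (Q ∩ {q : ℝ × F | 0 ≤ q.1 + ε * b q.2}) =
      S p ∩ Set.Ici (-(ε * b p)) := by
    intro ε p; ext t
    simp only [Set.mem_preimage, Set.mem_inter_iff, Set.mem_ofPred_eq, Set.mem_Ici, S]
    exact and_congr_right fun _ => ⟨fun h => by linarith, fun h => by linarith⟩
  have hφint : ∀ ε : ℝ, Integrable (fun p => volume.real (S p ∩ Set.Ici (-(ε * b p)))) ν := by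
    intro ε
    have := Measure.integrable_measure_prodMk_left (μ := ν) (ν := (volume : Measure ℝ))
      (s := Prod.swap ⁻¹' (Q ∩ {q : ℝ × F | 0 ≤ q.1 + ε * b q.2})) (measurable_swap (hmeas ε))
      (by rw [← Measure.map_apply measurable_swap (hmeas ε), Measure.prod_swap]; exact hfin ε)
    refine this.congr (ae_of_all _ fun p => ?_)
    simp only [← hfib]
    rfl
  have hφ : ∀ ε : ℝ, (volume.prod ν).real (Q ∩ {q : ℝ × F | 0 ≤ q.1 + ε * b q.2}) =
      ∫ p, volume.real (S p ∩ Set.Ici (-(ε * b p))) ∂ν := by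
    intro ε
    rw [Measure.real, Measure.prod_apply_symm (hmeas ε), ← integral_toReal]
    · simp only [hfib]; rfl
    · exact (measurable_measure_prodMk_right (hmeas ε)).aemeasurable
    · refine ae_of_all _ fun p => ?_
      rw [hfib]
      exact (measure_mono Set.inter_subset_left).trans_lt (hS p).measure_lt_top
  have hD : ∀ ε > 0, 0 ≤ ∫ p, D ε p / ε ∂ν := by
    intro ε hε
    rw [integral_div]
    refine div_nonneg ?_ hε.le
    have h0 := hφint 0
    have e0 := hφ 0
    simp only [zero_mul, neg_zero, add_zero] at h0 e0
    simp only [D]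
    rw [integral_sub (hφint ε) h0, ← hφ ε, ← e0]
    linarith [hb ε hε]
  have hlim : Tendsto (fun ε => ∫ p, D ε p / ε ∂ν) (𝓝[>] 0) (𝓝 (∫ p, K.indicator b p ∂ν)) := by
    refine tendsto_integral_filter_of_dominated_convergence
      ((Prod.snd '' Q).indicator fun p => |b p|) ?_ ?_ ?_ ?_
    · refine Eventually.of_forall fun ε => ?_
      have h0 := hφint 0
      simp only [zero_mul, neg_zero] at h0
      exact (((hφint ε).sub h0).div_const ε).aestronglyMeasurable
    · filter_upwards [self_mem_nhdsWithin] with ε hε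
      have hε : 0 < ε := hε
      refine ae_of_all _ fun p => ?_
      by_cases hp : p ∈ Prod.snd '' Q
      · rw [Set.indicator_of_mem hp, Real.norm_eq_abs, abs_div, abs_of_pos hε, div_le_iff₀ hε]
        calc |D ε p| ≤ |-(ε * b p)| := abs_volume_inter_Ici_sub_le (hS p) (hSc p) _
          _ = |b p| * ε := by rw [abs_neg, abs_mul, abs_of_pos hε, mul_comm]
      · have : S p = ∅ := by
          ext t; simp only [Set.mem_empty_iff_false, iff_false]
          exact fun h => hp ⟨(t, p), h, rfl⟩
        rw [Set.indicator_of_notMem hp]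
        simp [D, this]
    · have hc := hQ.image (continuous_snd (X := ℝ) (Y := F))
      rw [integrable_indicator_iff hc.measurableSet]
      exact (b.continuous.abs).continuousOn.integrableOn_compact hc
    · have hfr : ∀ᵐ p ∂ν, p ∉ frontier K := measure_eq_zero_iff_ae_notMem.1 (hKc.addHaar_frontier ν)
      filter_upwards [hfr] with p hp
      have hc : Tendsto (fun ε : ℝ => -(ε * b p)) (𝓝[>] 0) (𝓝 0) := by
        have : Continuous fun ε : ℝ => -(ε * b p) := by fun_prop
        have := this.tendsto 0
        simp only [zero_mul, neg_zero] at this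
        exact this.mono_left nhdsWithin_le_nhds
      refine tendsto_const_nhds.congr' ?_
      by_cases hpK : p ∈ K
      · have hpi : p ∈ interior K := by
          by_contra h
          exact hp ⟨subset_closure hpK, h⟩
        obtain ⟨δ₁, hδ₁, hm₁⟩ := exists_mem_fiber_of_mem_interior hQc h₁ hpi
        obtain ⟨δ₂, hδ₂, hm₂⟩ := exists_mem_fiber_of_mem_interior hQc h₂ hpi
        have hn : S p ∈ 𝓝 0 := by
          refine mem_of_superset (Icc_mem_nhds (mul_neg_of_pos_of_neg hδ₁ ht₁) (mul_pos hδ₂ ht₂)) ?_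
          exact (hSc p).ordConnected.out hm₁ hm₂
        filter_upwards [hc.eventually (eventually_volume_inter_Ici_of_mem_nhds (hS p) (hSc p) hn),
          self_mem_nhdsWithin] with ε h hε
        have hε : 0 < ε := hε
        rw [Set.indicator_of_mem hpK]
        simp only [D, h]
        field_simp
      · filter_upwards [hc.eventually (eventually_volume_inter_Ici_of_notMem (hS p) (hSc p) hpK)]
          with ε h
        rw [Set.indicator_of_notMem hpK]
        simp only [D, h, zero_div]
  rw [← integral_indicator hKcl.measurableSet]
  exact ge_of_tendsto hlim (by filter_upwards [self_mem_nhdsWithin] with ε hε using hD ε hε)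

lemma exists_pos_fst_of_measure_pos {F : Type*} [MeasurableSpace F] (ν : Measure F) [SFinite ν]
    {Q : Set (ℝ × F)}
    (hs : 0 < (volume.prod ν).real (Q ∩ {q | 0 ≤ q.1})) : ∃ q ∈ Q, 0 < q.1 := by
  by_contra! hcon
  have hsub : Q ∩ {q | 0 ≤ q.1} ⊆ {0} ×ˢ Set.univ := fun q hq =>
    ⟨le_antisymm (hcon q hq.1) hq.2, trivial⟩
  have : (volume.prod ν) (Q ∩ {q | 0 ≤ q.1}) = 0 :=
    measure_mono_null hsub (by rw [Measure.prod_prod]; simp)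
  simp [Measure.real, this] at hs

/-- If no tilt of the cap `{0 ≤ t}` of `Q` about the origin decreases its volume, then the segment
from the origin to `(-τ, 0)` contains a point which is deep in `Q`. -/
lemma exists_deep_point (ν : Measure F) [ν.IsAddHaarMeasure] {Q : Set (ℝ × F)}
    (hQ : IsCompact Q) (hQc : Convex ℝ Q) {τ η : ℝ} (hτ : 0 < τ) (hη : 0 < η)
    (h0 : (0, 0) ∈ Q) (hx : (-τ, 0) ∈ Q) (hcap : ∀ q ∈ Q, q.1 ≤ η)
    (hs : 0 < (volume.prod ν).real (Q ∩ {q | 0 ≤ q.1}))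
    (hmin : ∀ b : F →L[ℝ] ℝ, (volume.prod ν).real (Q ∩ {q | 0 ≤ q.1}) ≤
      (volume.prod ν).real (Q ∩ {q | 0 ≤ q.1 + b q.2}))
    (hητ : η / τ ≤ 1 / (Module.finrank ℝ F + 1)) :
    ∃ σ ∈ Set.Icc 0 τ, ∀ (a : ℝ) (b : F →L[ℝ] ℝ),
      τ * (volume.prod ν).real (Q ∩ {q | 0 ≤ q.1}) ≤
        2 * Real.exp 1 * (Module.finrank ℝ F + 1) ^ 3 * η *
          (volume.prod ν).real (Q ∩ {q | 0 ≤ a * (q.1 + σ) + b q.2}) := by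
  obtain ⟨⟨t₂, p₂⟩, hq₂, ht₂⟩ := exists_pos_fst_of_measure_pos ν hs
  have hA := measure_cap_le_of_apex ν hQ hQc hτ hη h0 hx hcap
  set n := Module.finrank ℝ F with hn
  have hbal : ∀ b : F →L[ℝ] ℝ, 0 ≤ ∫ p in {p | ((0 : ℝ), p) ∈ Q}, b p ∂ν := fun b =>
    setIntegral_section_nonneg_of_tilt ν hQ hQc (neg_lt_zero.2 hτ) ht₂ hx hq₂ b
      fun ε _ => by simpa using hmin (ε • b)
  have hKc := convex_section hQc 0
  have hK := isCompact_section hQ 0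
  set K := {p | ((0 : ℝ), p) ∈ Q}
  set l : ℝ := (1 / 2) ^ ((n + 1 : ℕ) : ℝ)⁻¹ with hl
  have hlpow : l ^ (n + 1) = 1 / 2 := Real.rpow_inv_natCast_pow (by norm_num) (by omega)
  have hl0 : 0 ≤ l := by positivity
  have hl1 : l ≤ 1 := Real.rpow_le_one (by norm_num) (by norm_num) (by positivity)
  have hσ : (1 + -((1 - l) * τ) / τ) = l := by field_simp; ring
  refine ⟨(1 - l) * τ, ⟨by nlinarith, by nlinarith⟩, fun a b => ?_⟩
  set G := Q ∩ {q | 0 ≤ a * (q.1 + (1 - l) * τ) + b q.2} with hGdef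
  have hGm : MeasurableSet G :=
    hQ.measurableSet.inter (isClosed_le continuous_const (by fun_prop)).measurableSet
  have hGfin : (volume.prod ν) G ≠ ⊤ :=
    ((measure_mono Set.inter_subset_left).trans_lt hQ.measure_lt_top).ne
  have hB := measureReal_le_mul_measureReal_inter_halfspace ν hK hKc b (hbal b)
  set B := K ∩ {p | 0 ≤ b p}
  have hcone : ∀ t ∈ Set.Icc (-τ) 0, ∀ p ∈ B, 0 ≤ a * (t + (1 - l) * τ) →
      (t, (1 + t / τ) • p) ∈ G := by
    intro t ht p hp ha
    have h1 : 0 ≤ 1 + t / τ := by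
      have : -1 ≤ t / τ := by rw [le_div_iff₀ hτ]; linarith [ht.1]
      linarith
    have h2 : 0 ≤ -t / τ := div_nonneg (by linarith [ht.2]) hτ.le
    refine ⟨?_, ?_⟩
    · have := hQc (show ((0 : ℝ), p) ∈ Q from hp.1) hx h1 h2 (by ring)
      convert this using 1
      ext
      · simp; field_simp
      · simp
    · have h3 : 0 ≤ b p := hp.2
      simp only [Set.mem_ofPred_eq, map_smul, smul_eq_mul]
      positivity
  have hvol : τ / (n + 1) * (1 / 2) * ν.real B ≤ (volume.prod ν).real G := by
    rcases le_total 0 a with ha | ha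
    · have := measure_cone_le ν (B := B) hGm hGfin hτ (α := -((1 - l) * τ)) (β := 0)
        (by nlinarith) (by nlinarith) fun t ht p hp =>
          hcone t ⟨by nlinarith [ht.1], ht.2⟩ p hp (mul_nonneg ha (by linarith [ht.1]))
      rw [hσ, hlpow] at this
      convert this using 3
      norm_num
    · have := measure_cone_le ν (B := B) hGm hGfin hτ (α := -τ) (β := -((1 - l) * τ))
        le_rfl (by nlinarith) fun t ht p hp =>
          hcone t ⟨ht.1, by nlinarith [ht.2]⟩ p hp
            (mul_nonneg_of_nonpos_of_nonpos ha (by linarith [ht.2]))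
      rw [hσ, hlpow] at this
      convert this using 3
      rw [neg_div, div_self hτ.ne']; simp
  have hpow : (1 + η / τ) ^ n ≤ n + 1 := one_add_pow_le_succ n (by positivity) hητ
  have he : 1 ≤ Real.exp 1 := Real.one_le_exp zero_le_one
  have hn0 : (0 : ℝ) ≤ n := by positivity
  set g := (volume.prod ν).real G
  have hB0 : 0 ≤ ν.real B := measureReal_nonneg
  have hK0 : 0 ≤ ν.real K := measureReal_nonneg
  calc τ * (volume.prod ν).real (Q ∩ {q | 0 ≤ q.1})
      ≤ τ * (η * (1 + η / τ) ^ n * ν.real K) := by gcongr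
    _ ≤ τ * (η * (n + 1) * ((n + Real.exp 1) * ν.real B)) := by gcongr
    _ ≤ τ * (η * (n + 1) * ((Real.exp 1 * (n + 1)) * ν.real B)) := by
        gcongr; nlinarith
    _ = 2 * Real.exp 1 * (n + 1) ^ 3 * η * (τ / (n + 1) * (1 / 2) * ν.real B) := by
        field_simp
    _ ≤ 2 * Real.exp 1 * (n + 1) ^ 3 * η * g := by gcongr

lemma exists_addHaar_prod_measurePreserving {E : Type*} [NormedAddCommGroup E] [NormedSpace ℝ E]
    [FiniteDimensional ℝ E] [MeasurableSpace E] [BorelSpace E] (μ : Measure E)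
    [μ.IsAddHaarMeasure] (L : (ℝ × F) ≃L[ℝ] E) :
    ∃ ν : Measure F, ν.IsAddHaarMeasure ∧ MeasurePreserving L (volume.prod ν) μ := by
  let ν₀ : Measure F := Measure.addHaar
  have : ((volume.prod ν₀ : Measure (ℝ × F)).map L).IsAddHaarMeasure :=
    L.isAddHaarMeasure_map _
  have hc := Measure.isAddLeftInvariant_eq_smul μ ((volume.prod ν₀ : Measure (ℝ × F)).map L)
  have hc0 := Measure.addHaarScalarFactor_pos_of_isAddHaarMeasure μ
    ((volume.prod ν₀ : Measure (ℝ × F)).map L)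
  set c := Measure.addHaarScalarFactor μ ((volume.prod ν₀ : Measure (ℝ × F)).map L)
  refine ⟨c • ν₀, Measure.IsAddHaarMeasure.nnreal_smul _ hc0.ne', L.continuous.measurable, ?_⟩
  have hsmul : volume.prod (c • ν₀) = (c : ENNReal) • (volume.prod ν₀ : Measure (ℝ × F)) :=
    Measure.prod_smul_right (c : ENNReal)
  rw [hsmul, Measure.map_smul]
  exact hc.symm

end

/-- The splitting of `E` as `ℝ e ⊕ ker f`, for a functional `f` with `f e = 1`. -/
noncomputable def prodKerEquiv {E : Type*} [NormedAddCommGroup E] [NormedSpace ℝ E]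
    [FiniteDimensional ℝ E] (f : E →ₗ[ℝ] ℝ) (e : E) (he : f e = 1) :
    (ℝ × LinearMap.ker f) ≃L[ℝ] E :=
  LinearEquiv.toContinuousLinearEquiv
    { toFun := fun q => q.1 • e + q.2
      map_add' := fun q r => by simp [add_smul]; abel
      map_smul' := fun c q => by simp [smul_smul]
      invFun := fun y => (f y, ⟨y - f y • e, by simp [he]⟩)
      left_inv := fun ⟨t, p, hp⟩ => by
        have : f p = 0 := hp
        ext <;> simp [he, this]
      right_inv := fun y => by simp }

lemma prodKerEquiv_apply {E : Type*} [NormedAddCommGroup E] [NormedSpace ℝ E]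
    [FiniteDimensional ℝ E] (f : E →ₗ[ℝ] ℝ) (e : E) (he : f e = 1) (q : ℝ × LinearMap.ker f) :
    prodKerEquiv f e he q = q.1 • e + q.2 := rfl

section

variable {d : ℕ} {P : Set (EuclideanSpace ℝ (Fin d))} {z : EuclideanSpace ℝ (Fin d)}

lemma vfun_le (w : EuclideanSpace ℝ (Fin d)) (hw : w ≠ 0) (c : ℝ) (hc : c ≤ ⟪w, z⟫) :
    vfun P z ≤ volume.real (P ∩ {x | c ≤ ⟪w, x⟫}) := by
  refine csInf_le ⟨0, ?_⟩ ⟨w, c, hw, hc, rfl⟩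
  rintro _ ⟨_, _, _, _, rfl⟩
  exact ENNReal.toReal_nonneg

lemma le_vfun (hP : volume P ≠ ⊤) {T : ℝ} {v : EuclideanSpace ℝ (Fin d)} (hv : v ≠ 0)
    (hT : ∀ w : EuclideanSpace ℝ (Fin d), T ≤ volume.real (P ∩ {x | ⟪w, z⟫ ≤ ⟪w, x⟫})) :
    T ≤ vfun P z := by
  refine le_csInf ⟨_, v, ⟪v, z⟫, hv, le_rfl, rfl⟩ ?_
  rintro _ ⟨w, c, -, hc, rfl⟩
  refine (hT w).trans (measureReal_mono (fun x hx => ⟨hx.1, hc.trans hx.2⟩) ?_)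
  exact ((measure_mono Set.inter_subset_left).trans_lt hP.lt_top).ne

/-- If a minimal cap of `z` is shallow compared with the depth of `x`, then `[x, z]` contains a
point `y` with large `v(y)`. -/
lemma exists_segment_le_vfun (hPconv : Convex ℝ P) (hPcomp : IsCompact P)
    {x : EuclideanSpace ℝ (Fin d)}
    (hzP : z ∈ P) (hxP : x ∈ P) {u : EuclideanSpace ℝ (Fin d)} (hu : u ≠ 0) {η T : ℝ} (hη : 0 < η)
    (hcap : ∀ y ∈ P, ⟪u, y⟫ ≤ ⟪u, z⟫ + η) (hs : 0 < vfun P z)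
    (hmin : volume.real (P ∩ {y | ⟪u, z⟫ ≤ ⟪u, y⟫}) = vfun P z)
    (hηx : d * η ≤ ⟪u, z⟫ - ⟪u, x⟫)
    (hT : 2 * Real.exp 1 * d ^ 3 * η * T ≤ (⟪u, z⟫ - ⟪u, x⟫) * vfun P z) :
    ∃ y ∈ segment ℝ x z, T ≤ vfun P y := by
  have hd : 0 < d := by
    rcases Nat.eq_zero_or_pos d with rfl | h
    · exact absurd (Subsingleton.elim u 0) hu
    · exact h
  have hd' : (0 : ℝ) < d := by exact_mod_cast hd
  set τ := ⟪u, z⟫ - ⟪u, x⟫ with hτdef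
  have hτ : 0 < τ := lt_of_lt_of_le (by positivity) hηx
  let f : EuclideanSpace ℝ (Fin d) →ₗ[ℝ] ℝ := (innerSL ℝ u).toLinearMap
  have hf : ∀ y, f y = ⟪u, y⟫ := fun y => rfl
  set e := τ⁻¹ • (z - x) with he
  have hfe : f e = 1 := by
    rw [hf, he, inner_smul_right, inner_sub_right, ← hτdef, inv_mul_cancel₀ hτ.ne']
  let L := prodKerEquiv f e hfe
  have hL : ∀ q, L q = q.1 • e + q.2 := prodKerEquiv_apply f e hfe
  have hfin : Module.finrank ℝ (LinearMap.ker f) + 1 = d := by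
    have := L.toLinearEquiv.finrank_eq
    simp at this
    omega
  obtain ⟨ν, hν, hLν⟩ := exists_addHaar_prod_measurePreserving volume L
  set Q : Set (ℝ × LinearMap.ker f) := (fun q => z + L q) ⁻¹' P
  have hmp : MeasurePreserving (fun q => z + L q) (volume.prod ν) volume :=
    (measurePreserving_add_left volume z).comp hLν
  have hPm := hPcomp.measurableSet
  have hvol : ∀ (w : EuclideanSpace ℝ (Fin d)) (c : ℝ),
      volume.real (P ∩ {y | c ≤ ⟪w, y⟫}) = (volume.prod ν).real
        (Q ∩ {q | c ≤ ⟪w, z⟫ + (q.1 * ⟪w, e⟫ + ⟪w, (q.2 : EuclideanSpace ℝ (Fin d))⟫)}) := by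
    intro w c
    have hm : MeasurableSet (P ∩ {y | c ≤ ⟪w, y⟫}) :=
      hPm.inter (isClosed_le continuous_const (by fun_prop)).measurableSet
    rw [Measure.real, ← hmp.measure_preimage hm.nullMeasurableSet, Measure.real]
    congr 2
    ext q
    simp only [Q, Set.mem_preimage, Set.mem_inter_iff, Set.mem_ofPred_eq, hL, inner_add_right,
      inner_smul_right]
  have hker : ∀ p : LinearMap.ker f, ⟪u, (p : EuclideanSpace ℝ (Fin d))⟫ = 0 := fun p => p.2
  have hue : ⟪u, e⟫ = 1 := hfe
  have hcapvol : (volume.prod ν).real (Q ∩ {q | 0 ≤ q.1}) = vfun P z := by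
    rw [← hmin, hvol u]
    simp [hker, hue]
  have hQ : IsCompact Q := by
    have : Q = ((Homeomorph.addLeft z).symm.trans L.symm.toHomeomorph) '' P := by
      rw [Homeomorph.image_eq_preimage_symm]; rfl
    rw [this]
    exact hPcomp.image (Homeomorph.continuous _)
  have hQc : Convex ℝ Q := by
    have : Q = L.toLinearMap ⁻¹' ((fun y => z + y) ⁻¹' P) := rfl
    rw [this]
    exact (hPconv.translate_preimage_right z).linear_preimage _
  obtain ⟨σ, hσ, hdeep⟩ := exists_deep_point ν hQ hQc hτ hη
    (by simpa [Q, hL] using hzP)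
    (by
      have : -τ • e = x - z := by
        rw [he, smul_smul, neg_mul, mul_inv_cancel₀ hτ.ne']; simp
      simpa [Q, hL, ← neg_smul, this] using hxP)
    (fun q hq => by
      have := hcap _ hq
      simp only [hL, inner_add_right, inner_smul_right, hker, hue] at this
      linarith)
    (by rwa [hcapvol])
    (fun b => by
      let g : EuclideanSpace ℝ (Fin d) →L[ℝ] ℝ :=
        (ContinuousLinearMap.fst ℝ ℝ _ + b.comp (ContinuousLinearMap.snd ℝ ℝ _)).comp
          (L.symm : EuclideanSpace ℝ (Fin d) →L[ℝ] ℝ × LinearMap.ker f)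
      have hg : ∀ q : ℝ × LinearMap.ker f, g (L q) = q.1 + b q.2 := fun q => by simp [g]
      set w := (InnerProductSpace.toDual ℝ _).symm g
      have hw : ∀ y, ⟪w, y⟫ = g y := fun y => by simp [w]
      have hwq : ∀ q : ℝ × LinearMap.ker f, q.1 * ⟪w, e⟫ + ⟪w, (q.2 : EuclideanSpace ℝ (Fin d))⟫ = q.1 + b q.2 := by
        intro q
        rw [← hg, hL, ← hw, inner_add_right, inner_smul_right (y := e)]
      have hw0 : w ≠ 0 := fun h => by
        have := hwq (1, 0)
        simp [h] at this
      rw [hcapvol]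
      refine (vfun_le w hw0 _ le_rfl).trans_eq ?_
      rw [hvol w]
      simp only [hwq, le_add_iff_nonneg_right])
    (by
      have : (Module.finrank ℝ (LinearMap.ker f) : ℝ) + 1 = d := by exact_mod_cast hfin
      rw [this, div_le_div_iff₀ hτ hd']
      linarith)
  have hfin' : (Module.finrank ℝ (LinearMap.ker f) : ℝ) + 1 = d := by exact_mod_cast hfin
  rw [hfin', hcapvol] at hdeep
  refine ⟨z + L (-σ, 0), ?_, le_vfun hPcomp.measure_lt_top.ne hu fun w => ?_⟩
  · rw [segment_symm, segment_eq_image']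
    refine ⟨σ / τ, ⟨div_nonneg hσ.1 hτ.le, (div_le_one hτ).2 hσ.2⟩, ?_⟩
    simp only [hL, he, smul_smul, Submodule.coe_zero, add_zero]
    rw [div_eq_mul_inv, neg_mul, neg_smul, ← smul_neg, neg_sub]
  · have h1 := hdeep ⟪w, e⟫ ((innerSL ℝ w).comp (LinearMap.ker f).subtypeL)
    have h2 : (volume.prod ν).real (Q ∩ {q | 0 ≤ ⟪w, e⟫ * (q.1 + σ) +
        ((innerSL ℝ w).comp (LinearMap.ker f).subtypeL) q.2}) =
        volume.real (P ∩ {y | ⟪w, z + L (-σ, 0)⟫ ≤ ⟪w, y⟫}) := by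
      rw [hvol w]
      congr 2
      ext q
      simp only [Set.mem_ofPred_eq, hL, inner_add_right, inner_smul_right,
        ContinuousLinearMap.comp_apply, Submodule.subtypeL_apply, innerSL_apply_apply,
        Submodule.coe_zero, inner_zero_right]
      constructor <;> intro h <;> linarith
    rw [h2, mul_comm _ (vfun P z)] at h1
    rw [mul_comm _ (vfun P z)] at hT
    exact le_of_mul_le_mul_left (hT.trans h1) (by positivity)

end

/-- Claim 9.1: with `v(z) = s`, `0 < s < 1/2`, `T ≥ s`, minimal cap
`C(z) = P ∩ {x : ⟪u,x⟫ ≥ h - h_z}` and `β = 2ed³ + 1`, the set `S(z,T)` of points visible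
from `z` within `P(v < T)` satisfies `S(z,T) ⊆ C^{βT/s}(z)`. -/
theorem stmt12 {d : ℕ} (P : Set (EuclideanSpace ℝ (Fin d)))
    (hPconv : Convex ℝ P) (hPcomp : IsCompact P) (hPint : (interior P).Nonempty)
    (hPvol : volume P = 1)
    (z : EuclideanSpace ℝ (Fin d)) (hzP : z ∈ P)
    (s T : ℝ) (hs0 : 0 < s) (hs1 : s < 1/2) (hTs : s ≤ T)
    (hvz : vfun P z = s)
    (u : EuclideanSpace ℝ (Fin d)) (hu : ‖u‖ = 1)
    (h : ℝ) (hsupp : IsGreatest ((fun x => ⟪u, x⟫) '' P) h)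
    (hz : ℝ) (hhz : 0 < hz)
    (hzC : z ∈ P ∩ {x | h - hz ≤ ⟪u, x⟫})
    (hCmin : volume (P ∩ {x | h - hz ≤ ⟪u, x⟫}) = ENNReal.ofReal s) :
    {x ∈ P | ∀ y ∈ segment ℝ x z, ¬ (y ∈ P ∧ T ≤ vfun P y)} ⊆
      P ∩ {x | h - ((2 * Real.exp 1 * d ^ 3 + 1) * T / s) * hz ≤ ⟪u, x⟫} := by
  rintro x ⟨hxP, hx⟩
  refine ⟨hxP, ?_⟩
  by_contra hcon
  simp only [Set.mem_ofPred_eq, not_le] at hcon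
  have hu0 : u ≠ 0 := fun h0 => by simp [h0] at hu
  have hzu : h - hz ≤ ⟪u, z⟫ := hzC.2
  have hT1 : 1 ≤ T / s := (one_le_div hs0).2 hTs
  set K := 2 * Real.exp 1 * (d : ℝ) ^ 3 with hK
  have hK0 : 0 ≤ K := by positivity
  have hdK : (d : ℝ) ≤ K := by
    have he : 1 ≤ Real.exp 1 := Real.one_le_exp zero_le_one
    have hd3 : (d : ℝ) ≤ (d : ℝ) ^ 3 := by exact_mod_cast Nat.le_self_pow (by norm_num) d
    nlinarith
  have hdepth : K * hz * (T / s) ≤ ⟪u, z⟫ - ⟪u, x⟫ := by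
    have : (K + 1) * T / s * hz = K * hz * (T / s) + T / s * hz := by ring
    nlinarith
  have hmin : volume.real (P ∩ {y | ⟪u, z⟫ ≤ ⟪u, y⟫}) = vfun P z := by
    refine le_antisymm ?_ (vfun_le u hu0 _ le_rfl)
    rw [hvz, ← ENNReal.toReal_ofReal hs0.le, ← hCmin]
    exact measureReal_mono (fun y hy => ⟨hy.1, hzu.trans hy.2⟩)
      (by rw [hCmin]; exact ENNReal.ofReal_ne_top)
  obtain ⟨y, hy, hTy⟩ := exists_segment_le_vfun hPconv hPcomp hzP hxP hu0 hhz (T := T)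
    (fun y hy => by
      have := hsupp.2 ⟨y, hy, rfl⟩
      simp only at this
      linarith)
    (by rwa [hvz]) hmin
    (by
      refine le_trans ?_ hdepth
      have : K * hz * 1 ≤ K * hz * (T / s) := by gcongr
      nlinarith)
    (by
      rw [hvz]
      calc K * hz * T = K * hz * (T / s) * s := by field_simp
        _ ≤ _ := by gcongr)
  exact hx y hy ⟨hPconv.segment_subset hxP hzP hy, hTy⟩
end

section
/- Let $P \subset \mathbb{R}^d$ be a convex body of volume $1$ and $0 < s \leq \tfrac12$. Let $z \in P$ with $v(z) = s$, let $C(z)$ be a minimal cap of $z$ with bounding hyperplane $H_{h_z}$ orthogonal to $u$ at depth $h_z$ below the supporting hyperplane $H_0$, and let $Q_z = P \cap H_{h_z}$. Then for every depth $h \in [0, h_z]$, the parallel section $P \cap H_h$ satisfies $$V_{d-1}(P \cap H_h) \leq 2d\, V_{d-1}(Q_z),$$ and consequently $s \leq 2d\, h_z\, V_{d-1}(Q_z)$. -/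
open MeasureTheory
open scoped RealInnerProductSpace

open Set Pointwise in
/-- The one-dimensional Brunn–Minkowski inequality. -/
theorem Real.volume_add_volume_le {A B C : Set ℝ} (hA : MeasurableSet A) (hB : MeasurableSet B)
    (hA0 : A.Nonempty) (hB0 : B.Nonempty) (hC : ∀ x ∈ A, ∀ y ∈ B, x + y ∈ C) :
    volume A + volume B ≤ volume C := by
  obtain ⟨a₀, ha₀⟩ := hA0
  obtain ⟨b₀, hb₀⟩ := hB0
  rcases eq_or_ne (volume A) 0 with hA' | hA'
  · rw [hA', zero_add, ← measure_preimage_add volume (-a₀) B]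
    refine measure_mono fun x hx => ?_
    simpa using hC a₀ ha₀ _ hx
  rcases eq_or_ne (volume B) 0 with hB' | hB'
  · rw [hB', add_zero, ← measure_preimage_add_right volume (-b₀) A]
    refine measure_mono fun x hx => ?_
    simpa using hC _ hx b₀ hb₀
  refine le_of_forall_lt fun c hc => ?_
  obtain ⟨r, hr, q, hq, hrq⟩ := ENNReal.exists_lt_add_of_lt_add hc hA' hB'
  obtain ⟨K, hKA, hK, hrK⟩ := hA.exists_lt_isCompact hr
  obtain ⟨L, hLB, hL, hqL⟩ := hB.exists_lt_isCompact hq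
  have hK0 : K.Nonempty := nonempty_of_measure_ne_zero hrK.ne_bot
  have hL0 : L.Nonempty := nonempty_of_measure_ne_zero hqL.ne_bot
  obtain ⟨k, hkK, hk⟩ := hK.exists_isGreatest hK0
  obtain ⟨l, hlL, hl⟩ := hL.exists_isLeast hL0
  have hKl : MeasurableSet ((fun x => x + -l) ⁻¹' K) :=
    hK.isClosed.measurableSet.preimage (measurable_add_const _)
  calc c < r + q := hrq
    _ ≤ volume K + volume L := add_le_add hrK.le hqL.le
    _ = volume ((fun x => -k + x) ⁻¹' L) + volume ((fun x => x + -l) ⁻¹' K) := by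
      rw [measure_preimage_add, measure_preimage_add_right, add_comm]
    _ = volume ((fun x => -k + x) ⁻¹' L ∪ (fun x => x + -l) ⁻¹' K) := by
      refine (measure_union₀ hKl.nullMeasurableSet ?_).symm
      refine measure_mono_null (fun x hx => ?_) (measure_singleton (k + l))
      have h1 := hk hx.2
      have h2 := hl hx.1
      simp only [mem_singleton_iff]
      linarith
    _ ≤ volume C := by
      refine measure_mono (union_subset (fun x hx => ?_) fun x hx => ?_)
      · simpa using hC k (hKA hkK) _ (hLB hx)
      · simpa using hC _ (hKA hx) l (hLB hlL)

open Set Pointwise in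
theorem Real.weighted_volume_add_le {A B C : Set ℝ} (hA : MeasurableSet A) (hB : MeasurableSet B)
    (hA0 : A.Nonempty) (hB0 : B.Nonempty) {a b : ℝ} (ha : 0 < a) (hb : 0 < b)
    (hC : ∀ x ∈ A, ∀ y ∈ B, a * x + b * y ∈ C) :
    ENNReal.ofReal a * volume A + ENNReal.ofReal b * volume B ≤ volume C := by
  have h := Real.volume_add_volume_le (hA.const_smul₀ a) (hB.const_smul₀ b)
    (hA0.smul_set (a := a)) (hB0.smul_set (a := b)) (C := C) (by
      rintro _ ⟨x, hx, rfl⟩ _ ⟨y, hy, rfl⟩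
      exact hC x hx y hy)
  simpa [Measure.addHaar_smul, abs_of_pos ha, abs_of_pos hb] using h

/-- Additive Prékopa–Leindler inequality on the line for functions with supremum `1`. -/
theorem lintegral_add_le_of_min_le {f g h : ℝ → ℝ} (hf : Measurable f) (hg : Measurable g)
    (hh : Measurable h) (hf0 : ∀ x, 0 ≤ f x) (hg0 : ∀ x, 0 ≤ g x) (hh0 : ∀ x, 0 ≤ h x)
    (hf1 : ∀ x, f x ≤ 1) (hg1 : ∀ x, g x ≤ 1)
    (hfs : ∀ t < 1, ∃ x, t < f x) (hgs : ∀ t < 1, ∃ x, t < g x)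
    {a b : ℝ} (ha : 0 < a) (hb : 0 < b)
    (hfgh : ∀ x y, min (f x) (g y) ≤ h (a * x + b * y)) :
    ENNReal.ofReal a * (∫⁻ x, ENNReal.ofReal (f x)) +
      ENNReal.ofReal b * (∫⁻ x, ENNReal.ofReal (g x)) ≤ ∫⁻ x, ENNReal.ofReal (h x) := by
  have meas : ∀ {f : ℝ → ℝ}, Measurable fun t => volume {x | t < f x} := fun {f} =>
    Antitone.measurable fun s t hst => measure_mono fun x hx => lt_of_le_of_lt hst hx
  rw [lintegral_eq_lintegral_meas_lt _ (.of_forall hf0) hf.aemeasurable,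
    lintegral_eq_lintegral_meas_lt _ (.of_forall hg0) hg.aemeasurable,
    lintegral_eq_lintegral_meas_lt _ (.of_forall hh0) hh.aemeasurable,
    ← lintegral_const_mul _ meas, ← lintegral_const_mul _ meas,
    ← lintegral_add_left (meas.const_mul _)]
  refine lintegral_mono fun t => ?_
  rcases lt_or_ge t 1 with ht | ht
  · refine Real.weighted_volume_add_le (measurableSet_lt measurable_const hf)
      (measurableSet_lt measurable_const hg) (hfs t ht) (hgs t ht) ha hb fun x hx y hy => ?_
    exact lt_of_lt_of_le (lt_min hx hy) (hfgh x y)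
  · have h1 : {x | t < f x} = ∅ := Set.eq_empty_of_forall_notMem fun x hx =>
      (lt_of_le_of_lt ht hx).not_ge (hf1 x)
    have h2 : {x | t < g x} = ∅ := Set.eq_empty_of_forall_notMem fun x hx =>
      (lt_of_le_of_lt ht hx).not_ge (hg1 x)
    simp [h1, h2]

theorem ENNReal.rpow_mul_rpow_le_add {X Y : ENNReal} (hX : X ≠ ⊤) (hY : Y ≠ ⊤) {a b : ℝ}
    (ha : 0 < a) (hb : 0 < b) (hab : a + b = 1) :
    X ^ a * Y ^ b ≤ ENNReal.ofReal a * X + ENNReal.ofReal b * Y := by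
  lift X to NNReal using hX
  lift Y to NNReal using hY
  lift a to NNReal using ha.le
  lift b to NNReal using hb.le
  rw [← ENNReal.coe_rpow_of_nonneg _ ha.le, ← ENNReal.coe_rpow_of_nonneg _ hb.le,
    ENNReal.ofReal_coe_nnreal, ENNReal.ofReal_coe_nnreal]
  exact_mod_cast NNReal.geom_mean_le_arith_mean2_weighted a b X Y (by exact_mod_cast hab)

/-- The Prékopa–Leindler inequality on the line, for bounded real functions. -/
theorem prekopaLeindler_real {f g h : ℝ → ℝ} (hf : Measurable f) (hg : Measurable g)
    (hh : Measurable h) (hf0 : ∀ x, 0 ≤ f x) (hg0 : ∀ x, 0 ≤ g x) (hh0 : ∀ x, 0 ≤ h x)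
    {K : ℝ} (hfK : ∀ x, f x ≤ K) (hgK : ∀ x, g x ≤ K)
    (hfi : ∫⁻ x, ENNReal.ofReal (f x) ≠ ⊤) (hgi : ∫⁻ x, ENNReal.ofReal (g x) ≠ ⊤)
    {a b : ℝ} (ha : 0 < a) (hb : 0 < b) (hab : a + b = 1)
    (hfgh : ∀ x y, f x ^ a * g y ^ b ≤ h (a * x + b * y)) :
    (∫⁻ x, ENNReal.ofReal (f x)) ^ a * (∫⁻ x, ENNReal.ofReal (g x)) ^ b ≤
      ∫⁻ x, ENNReal.ofReal (h x) := by
  have hfB : BddAbove (Set.range f) := ⟨K, by rintro _ ⟨x, rfl⟩; exact hfK x⟩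
  have hgB : BddAbove (Set.range g) := ⟨K, by rintro _ ⟨x, rfl⟩; exact hgK x⟩
  set M := ⨆ x, f x with hM
  set N := ⨆ x, g x with hN
  have hfM : ∀ x, f x ≤ M := le_ciSup hfB
  have hgN : ∀ x, g x ≤ N := le_ciSup hgB
  rcases ((hf0 0).trans (hfM 0)).eq_or_lt with hM0 | hM0
  · have : ∀ x, f x = 0 := fun x => le_antisymm (hM0 ▸ hfM x) (hf0 x)
    simp [this, ha]
  rcases ((hg0 0).trans (hgN 0)).eq_or_lt with hN0 | hN0
  · have : ∀ x, g x = 0 := fun x => le_antisymm (hN0 ▸ hgN x) (hg0 x)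
    simp [this, hb]
  have hMN : 0 < M ^ a * N ^ b := by positivity
  have scale : ∀ {k : ℝ → ℝ} {c : ℝ}, 0 < c →
      ∫⁻ x, ENNReal.ofReal (k x) =
        ENNReal.ofReal c * ∫⁻ x, ENNReal.ofReal (k x / c) := by
    intro k c hc
    rw [← lintegral_const_mul' _ _ ENNReal.ofReal_ne_top]
    refine lintegral_congr fun x => ?_
    rw [← ENNReal.ofReal_mul hc.le, mul_div_cancel₀ _ hc.ne']
  have key := lintegral_add_le_of_min_le (f := fun x => f x / M) (g := fun x => g x / N)
    (h := fun x => h x / (M ^ a * N ^ b)) (hf.div_const _) (hg.div_const _) (hh.div_const _)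
    (fun x => div_nonneg (hf0 x) hM0.le) (fun x => div_nonneg (hg0 x) hN0.le)
    (fun x => div_nonneg (hh0 x) hMN.le)
    (fun x => (div_le_one hM0).2 (hfM x)) (fun x => (div_le_one hN0).2 (hgN x))
    (fun t ht => by
      obtain ⟨x, hx⟩ := exists_lt_of_lt_ciSup (f := f) (b := t * M) (by
        change t * M < M
        nlinarith)
      exact ⟨x, (lt_div_iff₀ hM0).2 hx⟩)
    (fun t ht => by
      obtain ⟨x, hx⟩ := exists_lt_of_lt_ciSup (f := g) (b := t * N) (by
        change t * N < N
        nlinarith)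
      exact ⟨x, (lt_div_iff₀ hN0).2 hx⟩) ha hb
    (fun x y => by
      have hp : 0 ≤ f x / M := div_nonneg (hf0 x) hM0.le
      have hq : 0 ≤ g y / N := div_nonneg (hg0 y) hN0.le
      calc min (f x / M) (g y / N)
          = min (f x / M) (g y / N) ^ a * min (f x / M) (g y / N) ^ b := by
            rw [← Real.rpow_add_of_nonneg (le_min hp hq) ha.le hb.le, hab, Real.rpow_one]
        _ ≤ (f x / M) ^ a * (g y / N) ^ b := by
            have := le_min hp hq
            gcongr
            · exact min_le_left _ _
            · exact min_le_right _ _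
        _ = f x ^ a * g y ^ b / (M ^ a * N ^ b) := by
            rw [Real.div_rpow (hf0 x) hM0.le, Real.div_rpow (hg0 y) hN0.le, div_mul_div_comm]
        _ ≤ h (a * x + b * y) / (M ^ a * N ^ b) := by
            gcongr
            exact hfgh x y)
  rw [scale hM0] at hfi
  rw [scale hN0] at hgi
  rw [scale hM0 (k := f), scale hN0 (k := g), scale hMN (k := h), ENNReal.mul_rpow_of_nonneg _ _ ha.le,
    ENNReal.mul_rpow_of_nonneg _ _ hb.le, mul_mul_mul_comm,
    ENNReal.ofReal_rpow_of_nonneg hM0.le ha.le, ENNReal.ofReal_rpow_of_nonneg hN0.le hb.le,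
    ← ENNReal.ofReal_mul (by positivity)]
  gcongr
  refine (ENNReal.rpow_mul_rpow_le_add ?_ ?_ ha hb hab).trans key
  · intro h
    rw [h, ENNReal.mul_top (by simpa using hM0)] at hfi
    exact hfi rfl
  · intro h
    rw [h, ENNReal.mul_top (by simpa using hN0)] at hgi
    exact hgi rfl

theorem prekopaLeindler {f g h : ℝ → ENNReal} (hf : Measurable f) (hg : Measurable g)
    (hh : Measurable h) {K : ENNReal} (hK : K ≠ ⊤)
    (hfK : ∀ x, f x ≤ K) (hgK : ∀ x, g x ≤ K) (hhK : ∀ x, h x ≤ K)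
    (hfi : ∫⁻ x, f x ≠ ⊤) (hgi : ∫⁻ x, g x ≠ ⊤)
    {a b : ℝ} (ha : 0 < a) (hb : 0 < b) (hab : a + b = 1)
    (hfgh : ∀ x y, f x ^ a * g y ^ b ≤ h (a * x + b * y)) :
    (∫⁻ x, f x) ^ a * (∫⁻ x, g x) ^ b ≤ ∫⁻ x, h x := by
  have conv : ∀ {k : ℝ → ENNReal}, (∀ x, k x ≤ K) →
      (fun x => ENNReal.ofReal (k x).toReal) = k := fun hk =>
    funext fun x => ENNReal.ofReal_toReal (ne_top_of_le_ne_top hK (hk x))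
  have := prekopaLeindler_real hf.ennreal_toReal hg.ennreal_toReal hh.ennreal_toReal
    (fun _ => ENNReal.toReal_nonneg) (fun _ => ENNReal.toReal_nonneg)
    (fun _ => ENNReal.toReal_nonneg) (K := K.toReal)
    (fun x => ENNReal.toReal_mono hK (hfK x)) (fun x => ENNReal.toReal_mono hK (hgK x))
    (by rwa [conv hfK]) (by rwa [conv hgK]) ha hb hab (fun x y => by
      rw [ENNReal.toReal_rpow, ENNReal.toReal_rpow, ← ENNReal.toReal_mul]
      exact ENNReal.toReal_mono (ne_top_of_le_ne_top hK (hhK _)) (hfgh x y))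
  rwa [conv hfK, conv hgK, conv hhK] at this

/-- Multiplicative form of log-concavity for functions with values in `[0, ∞]`. -/
def IsLogConcave {V : Type*} [AddCommMonoid V] [Module ℝ V] (F : V → ENNReal) : Prop :=
  ∀ x y (a b : ℝ), 0 < a → 0 < b → a + b = 1 → F x ^ a * F y ^ b ≤ F (a • x + b • y)

/-- Marginals of bounded, boundedly supported log-concave functions are log-concave. -/
theorem IsLogConcave.marginal {n : ℕ} {F : ℝ × (Fin n → ℝ) → ENNReal} (hF : IsLogConcave F)
    (hm : Measurable F) {K : ENNReal} (hK : K ≠ ⊤) (hFK : ∀ p, F p ≤ K) {R : ℝ}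
    (hR : ∀ t x, F (t, x) ≠ 0 → ‖x‖ ≤ R) :
    IsLogConcave fun t => ∫⁻ x, F (t, x) := by
  induction n generalizing K with
  | zero =>
    intro t s a b ha hb hab
    have h1 : volume (Set.univ : Set (Fin 0 → ℝ)) = 1 := by
      rw [Measure.volume_pi_eq_dirac]
      simp
    simp only [lintegral_unique, h1, mul_one]
    have := hF (t, default) (s, default) a b ha hb hab
    rw [Prod.smul_mk, Prod.smul_mk, Prod.mk_add_mk] at this
    convert! this using 3 <;> exact congrArg F (Prod.ext rfl (Subsingleton.elim _ _))
  | succ n ih =>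
    set G : ℝ × (Fin n → ℝ) → ENNReal := fun p => ∫⁻ r, F (p.1, Fin.cons r p.2) with hG
    have hcons : Measurable fun q : (ℝ × (Fin n → ℝ)) × ℝ =>
        (q.1.1, (Fin.cons q.2 q.1.2 : Fin (n + 1) → ℝ)) := by
      refine (measurable_fst.fst).prodMk (measurable_pi_iff.2 fun i => ?_)
      refine Fin.cases ?_ (fun j => ?_) i
      · simpa using measurable_snd
      · simpa [Function.comp_def] using (measurable_pi_apply j).comp (measurable_fst.snd)
    have hm' := hm.comp hcons
    have hslice : ∀ p : ℝ × (Fin n → ℝ), Measurable fun r => F (p.1, Fin.cons r p.2) := fun p =>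
      hm'.comp measurable_prodMk_left
    have hGm : Measurable G := hm'.lintegral_prod_right'
    have hGK : ∀ p, G p ≤ K * volume (Set.Icc (-R) R) := by
      intro p
      rw [← setLIntegral_const]
      rw [← lintegral_indicator measurableSet_Icc]
      refine lintegral_mono fun r => ?_
      by_cases h0 : F (p.1, Fin.cons r p.2) = 0
      · simp [h0]
      · have := (norm_le_pi_norm (Fin.cons r p.2 : Fin (n + 1) → ℝ) 0).trans (hR _ _ h0)
        rw [Set.indicator_of_mem]
        · exact hFK _
        · simpa [abs_le] using this
    have hK' : K * volume (Set.Icc (-R) R) ≠ ⊤ := ENNReal.mul_ne_top hK (by simp)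
    have hGR : ∀ t x, G (t, x) ≠ 0 → ‖x‖ ≤ R := by
      intro t x hx
      obtain ⟨r, hr⟩ : ∃ r, F (t, Fin.cons r x) ≠ 0 := by
        by_contra! hcon
        exact hx (by simp [hG, hcon])
      have h1 := hR _ _ hr
      refine (pi_norm_le_iff_of_nonneg ((norm_nonneg _).trans h1)).2 fun i => ?_
      simpa using (norm_le_pi_norm (Fin.cons r x : Fin (n + 1) → ℝ) i.succ).trans h1
    have hGlc : IsLogConcave G := by
      intro p q a b ha hb hab
      refine prekopaLeindler (hslice p) (hslice q) (hslice _) hK (fun _ => hFK _) (fun _ => hFK _)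
        (fun _ => hFK _) (ne_top_of_le_ne_top hK' (hGK p)) (ne_top_of_le_ne_top hK' (hGK q))
        ha hb hab fun x y => ?_
      have := hF (p.1, Fin.cons x p.2) (q.1, Fin.cons y q.2) a b ha hb hab
      have hpt : a • (p.1, (Fin.cons x p.2 : Fin (n + 1) → ℝ)) + b • (q.1, Fin.cons y q.2) =
          ((a • p + b • q).1, Fin.cons (a * x + b * y) (a • p + b • q).2) := by
        refine Prod.ext rfl (funext fun i => ?_)
        refine Fin.cases ?_ (fun j => ?_) i <;> simp
      rwa [hpt] at this
    have hFG : (fun t => ∫⁻ x, F (t, x)) = fun t => ∫⁻ y, G (t, y) := by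
      funext t
      have hmp := (volume_preserving_piFinSuccAbove (fun _ : Fin (n + 1) => ℝ) 0).symm
      rw [← hmp.lintegral_comp (f := fun x => F (t, x)) (hm.comp measurable_prodMk_left),
        Measure.volume_eq_prod,
        lintegral_prod_symm]
      · simp only [hG, MeasurableEquiv.piFinSuccAbove_symm_apply, Fin.insertNthEquiv_zero]
        rfl
      · exact ((hm.comp measurable_prodMk_left).comp hmp.measurable).aemeasurable
    rw [hFG]
    exact ih hGlc hGm hK' hGK hGR

/-- A log-concave function of mass at most `1` is, to the right of a point whose left tail has mass
at least `1 / 2`, bounded by twice its value at that point. -/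
theorem IsLogConcave.le_two_mul {f : ℝ → ENNReal} (hf : IsLogConcave f) (hm : Measurable f)
    (hf1 : ∫⁻ x, f x ≤ 1) {τ t : ℝ} (hτ : 1 / 2 ≤ ∫⁻ x in Set.Iio τ, f x) (ht : τ ≤ t) :
    f t ≤ 2 * f τ := by
  rcases ht.eq_or_lt with rfl | ht
  · exact le_mul_of_one_le_left' one_le_two
  have hpt : ∀ x ∈ Set.Iio τ, f x * f t ≤ f (x + (t - τ)) * f τ := by
    intro x hx
    have hx : x < τ := hx
    have h0 : 0 < t - x := by linarith
    have ha : 0 < (τ - x) / (t - x) := div_pos (by linarith) h0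
    have hb : 0 < (t - τ) / (t - x) := div_pos (by linarith) h0
    have hab : (τ - x) / (t - x) + (t - τ) / (t - x) = 1 := by field_simp; ring
    have h1 := hf x t _ _ ha hb hab
    have h2 := hf x t _ _ hb ha ((add_comm _ _).trans hab)
    have e1 : ((τ - x) / (t - x)) • x + ((t - τ) / (t - x)) • t = x + (t - τ) := by
      simp only [smul_eq_mul]; field_simp; ring
    have e2 : ((t - τ) / (t - x)) • x + ((τ - x) / (t - x)) • t = τ := by
      simp only [smul_eq_mul]; field_simp; ring
    rw [e1] at h1
    rw [e2] at h2
    refine le_trans (le_of_eq ?_) (mul_le_mul' h1 h2)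
    rw [mul_mul_mul_comm, ← ENNReal.rpow_add_of_nonneg _ _ ha.le hb.le,
      ← ENNReal.rpow_add_of_nonneg _ _ hb.le ha.le, add_comm ((t - τ) / (t - x)), hab,
      ENNReal.rpow_one, ENNReal.rpow_one]
  have h3 : 1 / 2 * f t ≤ f τ :=
    calc 1 / 2 * f t ≤ (∫⁻ x in Set.Iio τ, f x) * f t := by gcongr
      _ = ∫⁻ x in Set.Iio τ, f x * f t := (lintegral_mul_const _ hm).symm
      _ ≤ ∫⁻ x in Set.Iio τ, f (x + (t - τ)) * f τ :=
        setLIntegral_mono ((hm.comp (measurable_add_const _)).mul_const _) hpt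
      _ ≤ ∫⁻ x, f (x + (t - τ)) * f τ := setLIntegral_le_lintegral _ _
      _ = (∫⁻ x, f x) * f τ := by
        rw [lintegral_add_right_eq_self (fun x => f x * f τ), lintegral_mul_const _ hm]
      _ ≤ f τ := mul_le_of_le_one_left' hf1
  calc f t = 2 * (1 / 2 * f t) := by
        rw [← mul_assoc, one_div, ENNReal.mul_inv_cancel two_ne_zero ENNReal.ofNat_ne_top, one_mul]
    _ ≤ 2 * f τ := by gcongr

/-- The `n`-dimensional Hausdorff measure on Euclidean `n`-space is a multiple of Lebesgue measure
by a finite factor at least `1`. -/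
theorem exists_hausdorffMeasure_toLp_image (n : ℕ) : ∃ c : NNReal, 1 ≤ c ∧
    ∀ S : Set (Fin n → ℝ), μH[(n : ℝ)] (WithLp.toLp 2 '' S) = c * volume S := by
  have : (μH[(n : ℝ)] : Measure (EuclideanSpace ℝ (Fin n))).IsAddHaarMeasure := by
    simpa using isAddHaarMeasure_hausdorffMeasure (E := EuclideanSpace ℝ (Fin n))
  obtain ⟨c, hc⟩ : ∃ c : NNReal,
      (μH[(n : ℝ)] : Measure (EuclideanSpace ℝ (Fin n))) = c • volume :=
    ⟨_, Measure.isAddLeftInvariant_eq_smul _ _⟩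
  have hS : ∀ S : Set (Fin n → ℝ), μH[(n : ℝ)] (WithLp.toLp 2 '' S) = c * volume S := by
    intro S
    have h1 := (EuclideanSpace.volume_preserving_symm_measurableEquiv_toLp
      (Fin n)).measure_preimage_equiv S
    have h2 : (MeasurableEquiv.toLp 2 (Fin n → ℝ)).symm ⁻¹' S = WithLp.toLp 2 '' S := by
      rw [← MeasurableEquiv.image_eq_preimage_symm]
      rfl
    rw [h2] at h1
    rw [hc, Measure.smul_apply, h1]
    rfl
  refine ⟨c, ?_, hS⟩
  have hcube : volume (Set.Icc (0 : Fin n → ℝ) 1) = 1 := by simp [Real.volume_Icc_pi]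
  have h1 := hS (Set.Icc 0 1)
  have h2 := (PiLp.lipschitzWith_ofLp 2 (fun _ : Fin n => ℝ)).hausdorffMeasure_image_le
    (Nat.cast_nonneg n) (WithLp.toLp 2 '' Set.Icc (0 : Fin n → ℝ) 1)
  rw [Set.image_image, Set.image_id', h1, hcube] at h2
  have h3 := congrArg (fun μ : Measure (Fin n → ℝ) => μ (Set.Icc 0 1))
    (hausdorffMeasure_pi_real (ι := Fin n))
  simp only [Fintype.card_fin, hcube] at h3
  rw [h3] at h2
  simpa using h2

/-- Orthogonal coordinates adapted to a unit vector. -/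
theorem exists_adapted_coordinates {n : ℕ} {u : EuclideanSpace ℝ (Fin (n + 1))} (hu : ‖u‖ = 1) :
    ∃ ψ : (ℝ × (Fin n → ℝ)) ≃L[ℝ] EuclideanSpace ℝ (Fin (n + 1)),
      MeasurePreserving ψ volume volume ∧ (∀ p, ⟪u, ψ p⟫ = p.1) ∧
      ∀ t, Isometry fun y : EuclideanSpace ℝ (Fin n) => ψ (t, WithLp.ofLp y) := by
  obtain ⟨b, hb⟩ := Orthonormal.exists_orthonormalBasis_extension_of_card_eq
    (𝕜 := ℝ) (E := EuclideanSpace ℝ (Fin (n + 1))) (ι := Fin (n + 1)) (by simp)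
    (v := fun _ => u) (s := {0}) (by
      rw [orthonormal_iff_ite]
      intro i j
      have : i = j := Subsingleton.elim _ _
      simp [this, hu])
  have hb0 : b 0 = u := hb 0 rfl
  let ψ : (ℝ × (Fin n → ℝ)) ≃L[ℝ] EuclideanSpace ℝ (Fin (n + 1)) :=
    (Fin.consEquivL ℝ fun _ : Fin (n + 1) => ℝ).trans
      ((PiLp.continuousLinearEquiv 2 ℝ fun _ : Fin (n + 1) => ℝ).symm.trans
        b.repr.symm.toContinuousLinearEquiv)
  have hψ : ∀ p, ψ p = b.repr.symm (WithLp.toLp 2 (Fin.cons p.1 p.2)) := fun p => rfl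
  refine ⟨ψ, ?_, fun p => ?_, fun t => ?_⟩
  · have h1 := (volume_preserving_piFinSuccAbove (fun _ : Fin (n + 1) => ℝ) 0).symm
    have h2 := PiLp.volume_preserving_toLp (Fin (n + 1))
    have h3 := b.measurePreserving_repr_symm
    convert! h3.comp (h2.comp h1) using 1
    funext p
    simp only [hψ, Function.comp_apply, MeasurableEquiv.piFinSuccAbove_symm_apply,
      Fin.insertNthEquiv_zero]
    rfl
  · rw [hψ, ← hb0, ← OrthonormalBasis.repr_apply_apply]
    simp
  · refine Isometry.of_dist_eq fun x y => ?_
    simp only [hψ]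
    rw [LinearIsometryEquiv.dist_map, EuclideanSpace.dist_eq, EuclideanSpace.dist_eq,
      Fin.sum_univ_succ]
    simp

theorem Convex.isLogConcave_indicator {V : Type*} [AddCommMonoid V] [Module ℝ V] {S : Set V}
    (hS : Convex ℝ S) : IsLogConcave (S.indicator fun _ => (1 : ENNReal)) := by
  intro x y a b ha hb hab
  by_cases hx : x ∈ S
  · by_cases hy : y ∈ S
    · simp [hx, hy, hS hx hy ha.le hb.le hab]
    · simp [hy, hb]
  · simp [hx, ha]

/-- The volumes of the parallel sections of a compact convex set form a log-concave function. -/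
theorem Convex.isLogConcave_volume_section {n : ℕ} {S : Set (ℝ × (Fin n → ℝ))}
    (hS : Convex ℝ S) (hc : IsCompact S) :
    IsLogConcave fun t => volume (Prod.mk t ⁻¹' S) := by
  have hm : MeasurableSet S := hc.isClosed.measurableSet
  obtain ⟨R, hR⟩ := hc.isBounded.exists_norm_le
  have h := hS.isLogConcave_indicator.marginal (measurable_const.indicator hm)
    ENNReal.one_ne_top (fun p => Set.indicator_le_self' (by simp) p) (R := R) (fun t x hx =>
      (norm_snd_le (t, x)).trans (hR _ (Set.mem_of_indicator_ne_zero hx)))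
  convert! h using 2 with t
  rw [← lintegral_indicator_one (hm.preimage measurable_prodMk_left)]
  rfl

/-- if `C(z) = P ∩ {x : ⟪u,x⟫ ≥ h - h_z}` is a minimal cap of `z` with
`v(z) = s ≤ 1/2` in a convex body of volume `1`, and `Q_z = P ∩ {⟪u,x⟫ = h - h_z}`, then
every parallel section at depth `hh ∈ [0, h_z]` has `(d-1)`-volume at most
`2d V_{d-1}(Q_z)`, and consequently `s ≤ 2d h_z V_{d-1}(Q_z)`. -/
theorem stmt14 {d : ℕ} (hd : 1 ≤ d) (P : Set (EuclideanSpace ℝ (Fin d)))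
    (hPconv : Convex ℝ P) (hPcomp : IsCompact P) (hPint : (interior P).Nonempty)
    (hPvol : volume P = 1)
    (s : ℝ) (hs0 : 0 < s) (hs1 : s ≤ 1/2)
    (z : EuclideanSpace ℝ (Fin d)) (hzP : z ∈ P) (hvz : vfun P z = s)
    (u : EuclideanSpace ℝ (Fin d)) (hu : ‖u‖ = 1)
    (h : ℝ) (hsupp : IsGreatest ((fun x => ⟪u, x⟫) '' P) h)
    (hz : ℝ) (hhz : 0 < hz)
    (hzC : z ∈ P ∩ {x | h - hz ≤ ⟪u, x⟫})
    (hCmin : volume (P ∩ {x | h - hz ≤ ⟪u, x⟫}) = ENNReal.ofReal s) :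
    (∀ hh ∈ Set.Icc (0 : ℝ) hz,
      (μH[(d : ℝ) - 1] (P ∩ {x | ⟪u, x⟫ = h - hh})).toReal ≤
        2 * d * (μH[(d : ℝ) - 1] (P ∩ {x | ⟪u, x⟫ = h - hz})).toReal) ∧
    s ≤ 2 * d * hz * (μH[(d : ℝ) - 1] (P ∩ {x | ⟪u, x⟫ = h - hz})).toReal := by
  obtain ⟨n, rfl⟩ : ∃ n, d = n + 1 := ⟨d - 1, by omega⟩
  obtain ⟨ψ, hψm, hψu, hψi⟩ := exists_adapted_coordinates hu
  obtain ⟨c, hc1, hc⟩ := exists_hausdorffMeasure_toLp_image n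
  set S : Set (ℝ × (Fin n → ℝ)) := ψ ⁻¹' P with hSdef
  have hScomp : IsCompact S := ψ.toHomeomorph.isCompact_preimage.2 hPcomp
  have hSconv : Convex ℝ S := hPconv.linear_preimage (ψ : (ℝ × (Fin n → ℝ)) →ₗ[ℝ] _)
  have hSm : MeasurableSet S := hScomp.isClosed.measurableSet
  have hPm : MeasurableSet P := hPcomp.isClosed.measurableSet
  set f : ℝ → ENNReal := fun t => volume (Prod.mk t ⁻¹' S) with hf
  have hflc : IsLogConcave f := hSconv.isLogConcave_volume_section hScomp
  have hfm : Measurable f := measurable_measure_prodMk_left hSm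
  have hffin : ∀ t, f t ≠ ⊤ := by
    intro t
    have : Prod.mk t ⁻¹' S ⊆ Prod.snd '' S := fun x hx => ⟨_, hx, rfl⟩
    exact ((measure_mono this).trans_lt (hScomp.image continuous_snd).measure_lt_top).ne
  have hslice : ∀ t, μH[((n + 1 : ℕ) : ℝ) - 1] (P ∩ {x | ⟪u, x⟫ = t}) = c * f t := by
    intro t
    have e : P ∩ {x | ⟪u, x⟫ = t} = (fun y : EuclideanSpace ℝ (Fin n) => ψ (t, WithLp.ofLp y)) ''
        (WithLp.toLp 2 '' (Prod.mk t ⁻¹' S)) := by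
      rw [Set.image_image]
      ext x
      constructor
      · rintro ⟨hxP, hxt⟩
        obtain ⟨⟨t', y⟩, rfl⟩ := ψ.surjective x
        obtain rfl : t' = t := by simpa [hψu] using hxt
        exact ⟨y, hxP, rfl⟩
      · rintro ⟨y, hy, rfl⟩
        exact ⟨hy, by simp [hψu]⟩
    have hn : ((n + 1 : ℕ) : ℝ) - 1 = n := by push_cast; ring
    rw [e, hn, (hψi t).hausdorffMeasure_image (.inl n.cast_nonneg), hc]
  have hvol : ∀ I : Set ℝ, MeasurableSet I →
      volume (P ∩ {x | ⟪u, x⟫ ∈ I}) = ∫⁻ t in I, f t := by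
    intro I hI
    have hIm : MeasurableSet (P ∩ {x | ⟪u, x⟫ ∈ I}) :=
      hPm.inter (hI.preimage (measurable_const.inner measurable_id))
    rw [← hψm.measure_preimage hIm.nullMeasurableSet, Measure.volume_eq_prod,
      Measure.prod_apply (hIm.preimage hψm.measurable), ← lintegral_indicator hI]
    refine lintegral_congr fun t => ?_
    by_cases ht : t ∈ I
    · rw [Set.indicator_of_mem ht]
      congr 1
      ext y
      simp [hψu, ht, hSdef]
    · rw [Set.indicator_of_notMem ht]
      convert! measure_empty (μ := (volume : Measure (Fin n → ℝ)))
      ext y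
      simp [hψu, ht]
  have htot : ∫⁻ t, f t = 1 := by
    have := hvol Set.univ MeasurableSet.univ
    simpa [hPvol] using this.symm
  have hcap : ∫⁻ t in Set.Ici (h - hz), f t = ENNReal.ofReal s :=
    (hvol _ measurableSet_Ici).symm.trans hCmin
  have hhalf : ENNReal.ofReal s ≤ 1 / 2 := by
    refine (ENNReal.ofReal_le_ofReal hs1).trans_eq ?_
    rw [ENNReal.ofReal_div_of_pos two_pos]
    simp
  have htail : 1 / 2 ≤ ∫⁻ t in Set.Iio (h - hz), f t := by
    have hadd := lintegral_add_compl f (measurableSet_Ici (a := h - hz)) (μ := volume)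
    rw [Set.compl_Ici, hcap, htot] at hadd
    refine ENNReal.le_of_add_le_add_left (a := 1 / 2) (by simp) ?_
    rw [ENNReal.add_halves]
    exact hadd.symm.trans_le (by gcongr)
  have hbound : ∀ t, h - hz ≤ t → f t ≤ 2 * f (h - hz) := fun t ht =>
    hflc.le_two_mul hfm htot.le htail ht
  have hreal : ∀ t, h - hz ≤ t → (f t).toReal ≤ 2 * (f (h - hz)).toReal := by
    intro t ht
    have := ENNReal.toReal_mono (ENNReal.mul_ne_top (by simp) (hffin _)) (hbound t ht)
    simpa using this
  have hd1 : (1 : ℝ) ≤ ((n + 1 : ℕ) : ℝ) := by exact_mod_cast hd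
  have hc1' : (1 : ℝ) ≤ c := by exact_mod_cast hc1
  have hm0 : 0 ≤ (f (h - hz)).toReal := ENNReal.toReal_nonneg
  have hcm : (f (h - hz)).toReal ≤ c * (f (h - hz)).toReal := le_mul_of_one_le_left hm0 hc1'
  simp only [hslice, ENNReal.toReal_mul, ENNReal.coe_toReal]
  refine ⟨fun hh hhI => ?_, ?_⟩
  · calc (c : ℝ) * (f (h - hh)).toReal ≤ c * (2 * (f (h - hz)).toReal) := by
          gcongr
          exact hreal _ (by linarith [hhI.2])
      _ = 2 * 1 * (c * (f (h - hz)).toReal) := by ring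
      _ ≤ 2 * ((n + 1 : ℕ) : ℝ) * (c * (f (h - hz)).toReal) := by gcongr
  · have hzero : ∀ t, h < t → f t = 0 := by
      intro t ht
      have : Prod.mk t ⁻¹' S = ∅ := by
        refine Set.eq_empty_of_forall_notMem fun y hy => ?_
        have := hsupp.2 ⟨ψ (t, y), hy, rfl⟩
        simp only [hψu] at this
        linarith
      simp [hf, this]
    have hle : ENNReal.ofReal s ≤ 2 * f (h - hz) * ENNReal.ofReal hz := by
      calc ENNReal.ofReal s = ∫⁻ t in Set.Ici (h - hz), f t := hcap.symm
        _ ≤ ∫⁻ t in Set.Icc (h - hz) h, 2 * f (h - hz) := by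
          rw [← lintegral_indicator measurableSet_Ici, ← lintegral_indicator measurableSet_Icc]
          refine lintegral_mono fun t => ?_
          by_cases h1 : h - hz ≤ t
          · by_cases h2 : t ≤ h
            · simpa [h1, h2] using hbound t h1
            · simp [h1, hzero t (not_le.1 h2)]
          · simp [h1]
        _ = 2 * f (h - hz) * ENNReal.ofReal hz := by
          rw [setLIntegral_const, Real.volume_Icc, sub_sub_cancel]
    have hle' : s ≤ 2 * (f (h - hz)).toReal * hz := by
      have := ENNReal.toReal_mono (ENNReal.mul_ne_top
        (ENNReal.mul_ne_top (by simp) (hffin _)) ENNReal.ofReal_ne_top) hle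
      simpa [ENNReal.toReal_ofReal hs0.le, ENNReal.toReal_ofReal hhz.le] using this
    calc s ≤ 2 * (f (h - hz)).toReal * hz := hle'
      _ = 2 * 1 * hz * (f (h - hz)).toReal := by ring
      _ ≤ 2 * ((n + 1 : ℕ) : ℝ) * hz * (c * (f (h - hz)).toReal) := by gcongr
end
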